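/- Under the conditions (★): (1) g_{0,1} ⊕ g_{2,1} is a symplectic subspace of (g^{(2)}_1, ω₂); (2) there exists a subspace a ⊆ g_{0,1} ∩ g^{f₁} (the centralizer of f₁) such that a ⊕ g_{2,1} is a Lagrangian subspace of g_{0,1} ⊕ g_{2,1}; (3) l₂ := a ⊕ g_{2,1} is isotropic in g^{(2)}_1 with ω₂-orthogonal l₂^{⊥,ω₂} = a ⊕ g_{1,1} ⊕ g_{2,1}. -/

import Mathlib

/-- Any subspace contains a subspace that is maximal isotropic in it for a given alternating
form. -/
lemma LinearMap.IsAlt.exists_maximal_isotropic {K V : Type*} [Field K] [AddCommGroup V]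
    [Module K V] [FiniteDimensional K V] {B : V →ₗ[K] V →ₗ[K] K} (hB : B.IsAlt)
    (A : Submodule K V) :
    ∃ W ≤ A, (∀ u ∈ W, ∀ v ∈ W, B u v = 0) ∧ ∀ v ∈ A, (∀ u ∈ W, B v u = 0) → v ∈ W := by
  obtain ⟨W, ⟨hWA, hW⟩, hmax⟩ := wellFounded_gt.has_min
    {W : Submodule K V | W ≤ A ∧ ∀ u ∈ W, ∀ v ∈ W, B u v = 0}
    ⟨⊥, bot_le, by simp⟩
  refine ⟨W, hWA, hW, fun v hvA hv => ?_⟩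
  by_contra hvW
  refine hmax (W ⊔ K ∙ v) ⟨sup_le hWA (by simpa using hvA), ?_⟩
    (lt_of_le_of_ne le_sup_left fun h => hvW ?_)
  · intro x hx y hy
    obtain ⟨w, hw, _, hc, rfl⟩ := Submodule.mem_sup.1 hx
    obtain ⟨w', hw', _, hc', rfl⟩ := Submodule.mem_sup.1 hy
    obtain ⟨c, rfl⟩ := Submodule.mem_span_singleton.1 hc
    obtain ⟨c', rfl⟩ := Submodule.mem_span_singleton.1 hc'
    have hv' : B w v = 0 := by rw [← hB.neg, hv w hw, neg_zero]
    simp [hW w hw w' hw', hv w' hw', hv', hB.self_eq_zero v]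
  · rw [h]
    exact Submodule.mem_sup_right (Submodule.mem_span_singleton_self v)

/-- The derivation acting on the component of degree `i` of a grading as multiplication by `i`. -/
lemma LieDerivation.exists_grading_derivation {K L : Type*} [Field K] [LieRing L]
    [LieAlgebra K L] {gr : ℤ → Submodule K L} (hgr : DirectSum.IsInternal gr)
    (hbr : ∀ i j : ℤ, ∀ x ∈ gr i, ∀ y ∈ gr j, ⁅x, y⁆ ∈ gr (i + j)) :
    ∃ D : LieDerivation K L L, ∀ i, ∀ x ∈ gr i, D x = (i : K) • x := by
  let e := LinearEquiv.ofBijective (DirectSum.coeLinearMap gr) hgr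
  let D : L →ₗ[K] L :=
    DirectSum.toModule K ℤ L (fun i => (i : K) • (gr i).subtype) ∘ₗ e.symm.toLinearMap
  have hD : ∀ i, ∀ x ∈ gr i, D x = (i : K) • x := by
    intro i x hx
    have : e.symm x = DirectSum.lof K ℤ (fun i => gr i) i ⟨x, hx⟩ := by
      rw [LinearEquiv.symm_apply_eq]
      exact (DirectSum.coeLinearMap_lof gr i ⟨x, hx⟩).symm
    simp [D, this]
  have hmem : ∀ x : L, x ∈ ⨆ i, gr i := fun x => by
    rw [hgr.submodule_iSup_eq_top]; trivial
  refine ⟨{ toLinearMap := D, leibniz' := fun a b => ?_ }, hD⟩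
  induction hmem a using Submodule.iSup_induction' with
  | zero => simp
  | add x y _ _ hx hy => simp only [add_lie, lie_add, map_add, hx, hy]; abel
  | mem i x hx =>
    induction hmem b using Submodule.iSup_induction' with
    | zero => simp
    | add x y _ _ hx hy => simp only [add_lie, lie_add, map_add, hx, hy]; abel
    | mem j y hy =>
      rw [hD _ _ (hbr i j x hx y hy), hD _ _ hx, hD _ _ hy, lie_smul, lie_smul,
        ← lie_skew x y]
      push_cast
      module

/-- Every grading of a Lie algebra with nonsingular Killing form is given by an inner derivation,
so components of nonopposite degrees are orthogonal for every invariant form. -/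
lemma LieAlgebra.IsKilling.apply_eq_zero_of_grading {K L : Type*} [Field K] [CharZero K]
    [LieRing L] [LieAlgebra K L] [FiniteDimensional K L] [LieAlgebra.IsKilling K L]
    {Φ : L →ₗ[K] L →ₗ[K] K} (hinv : ∀ x y z : L, Φ ⁅x, y⁆ z = Φ x ⁅y, z⁆)
    {gr : ℤ → Submodule K L} (hgr : DirectSum.IsInternal gr)
    (hbr : ∀ i j : ℤ, ∀ x ∈ gr i, ∀ y ∈ gr j, ⁅x, y⁆ ∈ gr (i + j))
    {i j : ℤ} (hij : i + j ≠ 0) {x y : L} (hx : x ∈ gr i) (hy : y ∈ gr j) : Φ x y = 0 := by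
  obtain ⟨D, hD⟩ := LieDerivation.exists_grading_derivation hgr hbr
  obtain ⟨h, rfl⟩ := LieDerivation.IsKilling.exists_eq_ad D
  have h1 : ⁅h, x⁆ = (i : K) • x := by simpa using hD i x hx
  have h2 : ⁅h, y⁆ = (j : K) • y := by simpa using hD j y hy
  have key := hinv x h y
  rw [← lie_skew, h1, h2] at key
  simp only [map_neg, map_smul, LinearMap.neg_apply, LinearMap.smul_apply, smul_eq_mul] at key
  have hne : (i : K) + (j : K) ≠ 0 := by exact_mod_cast hij
  exact (mul_eq_zero.1 (show ((i : K) + j) * Φ x y = 0 by linear_combination -key)).resolve_left hne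

/-- A vector orthogonal to all components of an internal decomposition is zero for a nondegenerate
form. -/
lemma DirectSum.IsInternal.eq_zero_of_orthogonal {ι K V : Type*} [DecidableEq ι] [Field K]
    [AddCommGroup V] [Module K V] {N : ι → Submodule K V} (hN : DirectSum.IsInternal N)
    {Φ : V →ₗ[K] V →ₗ[K] K} (hΦ : ∀ x, (∀ y, Φ x y = 0) → x = 0) {x : V}
    (hx : ∀ i, ∀ y ∈ N i, Φ x y = 0) : x = 0 := by
  have hle : ⨆ i, N i ≤ LinearMap.ker (Φ x) := iSup_le fun i y hy => hx i y hy
  rw [hN.submodule_iSup_eq_top] at hle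
  exact hΦ x fun y => hle trivial

/-- Under the conditions (★):
(1) `g_{0,1} ⊕ g_{2,1}` is a symplectic subspace of `(g^{(2)}₁, ω₂)`;
(2) there exists a subspace `a ⊆ g_{0,1} ∩ g^{f₁}` such that `a ⊕ g_{2,1}` is a
Lagrangian subspace of `g_{0,1} ⊕ g_{2,1}`;
(3) `l₂ := a ⊕ g_{2,1}` is isotropic in `g^{(2)}₁` with `ω₂`-orthogonal
`l₂^{⊥,ω₂} = a ⊕ g_{1,1} ⊕ g_{2,1}`. -/
theorem statement9
    (g : Type*) [LieRing g] [LieAlgebra ℂ g] [FiniteDimensional ℂ g]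
    [LieAlgebra.IsSimple ℂ g]
    (Φ : g →ₗ[ℂ] g →ₗ[ℂ] ℂ)
    (hsymm : ∀ x y : g, Φ x y = Φ y x)
    (hinv : ∀ x y z : g, Φ ⁅x, y⁆ z = Φ x ⁅y, z⁆)
    (hnondeg : ∀ x : g, (∀ y : g, Φ x y = 0) → x = 0)
    (gr1 gr2 : ℤ → Submodule ℂ g)
    (hdec1 : DirectSum.IsInternal fun δ : ℤ => gr1 δ)
    (hdec2 : DirectSum.IsInternal fun δ : ℤ => gr2 δ)
    (hbidec : DirectSum.IsInternal fun p : ℤ × ℤ => gr1 p.1 ⊓ gr2 p.2)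
    (hbr1 : ∀ δ₁ δ₂ : ℤ, ∀ x ∈ gr1 δ₁, ∀ y ∈ gr1 δ₂, ⁅x, y⁆ ∈ gr1 (δ₁ + δ₂))
    (hbr2 : ∀ δ₁ δ₂ : ℤ, ∀ x ∈ gr2 δ₁, ∀ y ∈ gr2 δ₂, ⁅x, y⁆ ∈ gr2 (δ₁ + δ₂))
    (f1 f2 : g) (hf1 : f1 ∈ gr1 (-2)) (hf2 : f2 ∈ gr2 (-2))
    (hgood1inj : ∀ δ : ℤ, 1 ≤ δ → ∀ x ∈ gr1 δ, ⁅f1, x⁆ = 0 → x = 0)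
    (hgood1surj : ∀ δ : ℤ, δ ≤ 1 → ∀ y ∈ gr1 (δ - 2), ∃ x ∈ gr1 δ, ⁅f1, x⁆ = y)
    (hgood2inj : ∀ δ : ℤ, 1 ≤ δ → ∀ x ∈ gr2 δ, ⁅f2, x⁆ = 0 → x = 0)
    (hgood2surj : ∀ δ : ℤ, δ ≤ 1 → ∀ y ∈ gr2 (δ - 2), ∃ x ∈ gr2 δ, ⁅f2, x⁆ = y)
    (hstar1 : (⨆ d : ℤ, ⨆ _ : (2 : ℤ) ≤ d, gr1 d) ≤ ⨆ d : ℤ, ⨆ _ : (1 : ℤ) ≤ d, gr2 d)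
    (hstar2 : (⨆ d : ℤ, ⨆ _ : (1 : ℤ) ≤ d, gr2 d) ≤ ⨆ d : ℤ, ⨆ _ : (0 : ℤ) ≤ d, gr1 d)
    (hstar3 : gr1 1 ≤ (gr1 1 ⊓ gr2 0) ⊔ (gr1 1 ⊓ gr2 1) ⊔ (gr1 1 ⊓ gr2 2))
    (hstar4 : gr2 1 ≤ (gr2 1 ⊓ gr1 0) ⊔ (gr2 1 ⊓ gr1 1) ⊔ (gr2 1 ⊓ gr1 2))
    (hstar5 : f2 - f1 ∈ gr1 0 ⊓ gr2 (-2))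
    :
    -- (1) nondegeneracy of ω₂ on g_{0,1} ⊕ g_{2,1}
    (∀ x ∈ (gr2 1 ⊓ gr1 0) ⊔ (gr2 1 ⊓ gr1 2),
      (∀ y ∈ (gr2 1 ⊓ gr1 0) ⊔ (gr2 1 ⊓ gr1 2), Φ f2 ⁅x, y⁆ = 0) → x = 0) ∧
    -- (2) & (3) existence of `a`
    (∃ aa : Submodule ℂ g,
      aa ≤ (gr2 1 ⊓ gr1 0) ⊓ LinearMap.ker (LieAlgebra.ad ℂ g f1 : g →ₗ[ℂ] g) ∧
      -- `a ⊕ g_{2,1}` is isotropic …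
      (∀ u ∈ aa ⊔ (gr2 1 ⊓ gr1 2), ∀ v ∈ aa ⊔ (gr2 1 ⊓ gr1 2), Φ f2 ⁅u, v⁆ = 0) ∧
      -- … and Lagrangian in `g_{0,1} ⊕ g_{2,1}`
      ({v : g | v ∈ (gr2 1 ⊓ gr1 0) ⊔ (gr2 1 ⊓ gr1 2) ∧
          ∀ u ∈ aa ⊔ (gr2 1 ⊓ gr1 2), Φ f2 ⁅v, u⁆ = 0}
        = ↑(aa ⊔ (gr2 1 ⊓ gr1 2))) ∧
      -- `l₂ = a ⊕ g_{2,1}` has ω₂-orthogonal `a ⊕ g_{1,1} ⊕ g_{2,1}` inside `g^{(2)}₁`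
      ({v : g | v ∈ gr2 1 ∧ ∀ u ∈ aa ⊔ (gr2 1 ⊓ gr1 2), Φ f2 ⁅v, u⁆ = 0}
        = ↑(aa ⊔ (gr2 1 ⊓ gr1 1) ⊔ (gr2 1 ⊓ gr1 2)))) := by
  have orth1 := fun {i j : ℤ} (hij : i + j ≠ 0) {x y : g} (hx : x ∈ gr1 i) (hy : y ∈ gr1 j) =>
    LieAlgebra.IsKilling.apply_eq_zero_of_grading hinv hdec1 hbr1 hij hx hy
  have orth2 := fun {i j : ℤ} (hij : i + j ≠ 0) {x y : g} (hx : x ∈ gr2 i) (hy : y ∈ gr2 j) =>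
    LieAlgebra.IsKilling.apply_eq_zero_of_grading hinv hdec2 hbr2 hij hx hy
  have hf1' : f1 ∈ gr2 (-2) := by simpa using sub_mem hf2 hstar5.2
  let ω : g →ₗ[ℂ] g →ₗ[ℂ] ℂ := (LieModule.toEnd ℂ g g : g →ₗ[ℂ] Module.End ℂ g).compr₂ (Φ f2)
  have hω (x y : g) : Φ f2 ⁅x, y⁆ = ω x y := rfl
  have hωalt : ω.IsAlt := fun x => by simp [← hω]
  have ω_split (x y : g) : ω x y = Φ f1 ⁅x, y⁆ + Φ (f2 - f1) ⁅x, y⁆ := by simp [← hω]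
  have ω_deg {i j : ℤ} (h2 : i + j ≠ 2) (h0 : i + j ≠ 0) {x y : g} (hx : x ∈ gr1 i)
      (hy : y ∈ gr1 j) : ω x y = 0 := by
    rw [ω_split, orth1 (by omega) hf1 (hbr1 i j x hx y hy),
      orth1 (by omega) hstar5.1 (hbr1 i j x hx y hy), add_zero]
  have ω_nondeg (x : g) (hx : x ∈ gr2 1) (h : ∀ y ∈ gr2 1, ω x y = 0) : x = 0 := by
    refine hgood2inj 1 le_rfl x hx (hdec2.eq_zero_of_orthogonal hnondeg fun i y hy => ?_)
    rcases eq_or_ne i 1 with rfl | hi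
    · rw [hinv]; exact h y hy
    · exact orth2 (by omega) (hbr2 _ _ _ hf2 _ hx) hy
  simp only [hω]
  set S := gr2 1 ⊓ gr1 0
  set T := gr2 1 ⊓ gr1 1
  set U := gr2 1 ⊓ gr1 2
  have hTS : ∀ t ∈ T, ∀ s ∈ S, ω t s = 0 := fun t ht s hs => ω_deg (by simp) (by simp) ht.2 hs.2
  have hTU : ∀ t ∈ T, ∀ u ∈ U, ω t u = 0 := fun t ht u hu => ω_deg (by simp) (by simp) ht.2 hu.2
  have hUU : ∀ u ∈ U, ∀ v ∈ U, ω u v = 0 := fun t ht u hu => ω_deg (by simp) (by simp) ht.2 hu.2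
  have hSU : ∀ s ∈ S, ∀ u ∈ U, ω s u = Φ ⁅f1, s⁆ u := fun s hs u hu => by
    rw [ω_split, orth1 (by simp) hstar5.1 (hbr1 0 2 s hs.2 u hu.2), add_zero, hinv]
  have hker : ∀ s ∈ S, (∀ u ∈ U, ω s u = 0) → ⁅f1, s⁆ = 0 := by
    intro s hs h
    refine hbidec.eq_zero_of_orthogonal hnondeg fun ⟨i, j⟩ y hy => ?_
    by_cases hi : i = 2
    · by_cases hj : j = 1
      · subst hi hj
        rw [← hSU s hs y ⟨hy.2, hy.1⟩]
        exact h y ⟨hy.2, hy.1⟩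
      · exact orth2 (by omega) (hbr2 _ _ _ hf1' _ hs.1) hy.2
    · exact orth1 (by omega) (hbr1 _ _ _ hf1 _ hs.2) hy.1
  have hle : S ⊔ U ≤ gr2 1 := sup_le inf_le_left inf_le_left
  refine ⟨fun x hx h => ω_nondeg x (hle hx) fun y hy => ?_, ?_⟩
  · obtain ⟨_, hst, u, hu, rfl⟩ := Submodule.mem_sup.1 (hstar4 hy)
    obtain ⟨s, hs, t, ht, rfl⟩ := Submodule.mem_sup.1 hst
    obtain ⟨s', hs', u', hu', rfl⟩ := Submodule.mem_sup.1 hx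
    have hxt : ω (s' + u') t = 0 := by
      rw [← hωalt.neg, map_add, hTS t ht s' hs', hTU t ht u' hu', add_zero, neg_zero]
    rw [map_add, map_add, hxt, h s (Submodule.mem_sup_left hs),
      h u (Submodule.mem_sup_right hu), add_zero, add_zero]
  obtain ⟨W, hWA, hWiso, hWmax⟩ := hωalt.exists_maximal_isotropic
    (S ⊓ LinearMap.ker (LieAlgebra.ad ℂ g f1 : g →ₗ[ℂ] g))
  have hWU : ∀ w ∈ W, ∀ u ∈ U, ω w u = 0 := fun w hw u hu => by
    have : ⁅f1, w⁆ = 0 := (hWA hw).2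
    rw [hSU w (hWA hw).1 u hu, this, map_zero, LinearMap.zero_apply]
  have hUW : ∀ u ∈ U, ∀ w ∈ W, ω u w = 0 := fun u hu w hw => by
    rw [← hωalt.neg, hWU w hw u hu, neg_zero]
  have hiso : ∀ u ∈ W ⊔ U, ∀ v ∈ W ⊔ U, ω u v = 0 := by
    intro x hx y hy
    obtain ⟨w, hw, u, hu, rfl⟩ := Submodule.mem_sup.1 hx
    obtain ⟨w', hw', u', hu', rfl⟩ := Submodule.mem_sup.1 hy
    simp [hWiso w hw w' hw', hWU w hw u' hu', hUW u hu w' hw', hUU u hu u' hu']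
  have hTl : ∀ t ∈ T, ∀ v ∈ W ⊔ U, ω t v = 0 := by
    intro t ht y hy
    obtain ⟨w, hw, u, hu, rfl⟩ := Submodule.mem_sup.1 hy
    rw [map_add, hTS t ht w (hWA hw).1, hTU t ht u hu, add_zero]
  have hmax : ∀ s ∈ S, (∀ v ∈ W ⊔ U, ω s v = 0) → s ∈ W := fun s hs h =>
    hWmax s ⟨hs, hker s hs fun u hu => h u (Submodule.mem_sup_right hu)⟩
      fun u hu => h u (Submodule.mem_sup_left hu)
  refine ⟨W, hWA, hiso, Set.ext fun v => ⟨?_, fun hv => ⟨?_, hiso v hv⟩⟩,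
    Set.ext fun v => ⟨?_, fun hv => ?_⟩⟩
  · rintro ⟨hv, h⟩
    obtain ⟨s, hs, u, hu, rfl⟩ := Submodule.mem_sup.1 hv
    refine Submodule.add_mem_sup (hmax s hs fun v hv => ?_) hu
    simpa [hiso u (Submodule.mem_sup_right hu) v hv] using h v hv
  · exact sup_le_sup_right (hWA.trans inf_le_left) U hv
  · rintro ⟨hv, h⟩
    obtain ⟨_, hst, u, hu, rfl⟩ := Submodule.mem_sup.1 (hstar4 hv)
    obtain ⟨s, hs, t, ht, rfl⟩ := Submodule.mem_sup.1 hst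
    refine Submodule.add_mem_sup (Submodule.add_mem_sup (hmax s hs fun v hv => ?_) ht) hu
    simpa [hiso u (Submodule.mem_sup_right hu) v hv, hTl t ht v hv] using h v hv
  · obtain ⟨_, hwt, u, hu, rfl⟩ := Submodule.mem_sup.1 hv
    obtain ⟨w, hw, t, ht, rfl⟩ := Submodule.mem_sup.1 hwt
    refine ⟨add_mem (add_mem (hWA hw).1.1 ht.1) hu.1, fun v hv => ?_⟩
    simp [hiso w (Submodule.mem_sup_left hw) v hv, hiso u (Submodule.mem_sup_right hu) v hv,
      hTl t ht v hv]
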